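/- Let p ∈ (1,∞), n ≥ 2, k ∈ {0,1,…,n−1}, and −∞ < a_i < b_i < ∞ for i = 1,…,n−k; set D = ℝ^k × ∏_{i=1}^{n−k}(a_i,b_i) ⊆ ℝⁿ. Then the norm of the canonical embedding W_0^{1,p}(D) ↪ L^p(D) equals (1 + π_p^p (p−1) Σ_{i=1}^{n−k} (b_i−a_i)^{−p})^{−1/p}. -/

import Mathlib

open MeasureTheory ENNReal Set Filter Topology

noncomputable section

/-- The `i`-th partial derivative of `u : ℝⁿ → ℝ`. -/
def pder {n : ℕ} (i : Fin n) (u : (Fin n → ℝ) → ℝ) (x : Fin n → ℝ) : ℝ :=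
  fderiv ℝ u x (Pi.single i 1)

/-- `u` is a smooth function compactly supported in the open set `D`. -/
def IsTestFun {n : ℕ} (D : Set (Fin n → ℝ)) (u : (Fin n → ℝ) → ℝ) : Prop :=
  ContDiff ℝ (⊤ : ℕ∞) u ∧ HasCompactSupport u ∧ tsupport u ⊆ D

/-- The strip-like domain `ℝᵏ × ∏_{i ≥ k} (aᵢ, bᵢ)`, realized as a subset of `ℝⁿ`:
the coordinates `i < k` are free, the coordinates `i ≥ k` are constrained to `(aᵢ, bᵢ)`. -/
def stripDomain (n k : ℕ) (a b : Fin n → ℝ) : Set (Fin n → ℝ) :=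
  {x | ∀ i : Fin n, k ≤ (i : ℕ) → x i ∈ Set.Ioo (a i) (b i)}

/-- The ambient space `V = L^p(ℝⁿ; ℓ^p(ℝ^{n+1}))`, in which the Sobolev space `W^{1,p}_0`
is realized as the closure of the set of "jets" `(u, ∇u)` of test functions. -/
abbrev Vsp (n : ℕ) (p : ℝ≥0∞) [Fact (1 ≤ p)] :=
  Lp (PiLp p (fun _ : Fin (n + 1) => ℝ)) p (volume : Measure (Fin n → ℝ))

/-- The "jet" `(u, ∂₁u, …, ∂ₙu)` of a function, valued in `ℓ^p(ℝ^{n+1})`. -/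
def jet {n : ℕ} (p : ℝ≥0∞) (u : (Fin n → ℝ) → ℝ) (x : Fin n → ℝ) :
    PiLp p (fun _ : Fin (n + 1) => ℝ) :=
  (WithLp.equiv p (∀ _ : Fin (n + 1), ℝ)).symm (Fin.cons (u x) (fun i => pder i u x))

/-- `W^{1,p}_0(D)` realized as a closed subspace of `V`:
the closure of the subspace of jets of test functions supported in `D`.
The (subspace) norm of the jet of `u` is exactly
`(‖u‖_p^p + ‖ |∇u|_{ℓ^p} ‖_p^p)^{1/p}`, i.e., the `W^{1,p}`-norm of `u`. -/
def W0sub {n : ℕ} (p : ℝ≥0∞) [Fact (1 ≤ p)] (D : Set (Fin n → ℝ)) : Submodule ℝ (Vsp n p) :=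
  (Submodule.span ℝ {f : Vsp n p | ∃ u : (Fin n → ℝ) → ℝ, IsTestFun D u ∧
    (f : (Fin n → ℝ) → PiLp p (fun _ : Fin (n + 1) => ℝ)) =ᵐ[volume] jet p u}).topologicalClosure

instance W0sub.completeSpace {n : ℕ} (p : ℝ≥0∞) [Fact (1 ≤ p)] (D : Set (Fin n → ℝ)) :
    CompleteSpace (W0sub (n := n) p D) :=
  (Submodule.isClosed_topologicalClosure _).completeSpace_coe

/-- Projection of a jet onto its zeroth (function) component. -/
def proj0 (n : ℕ) (p : ℝ≥0∞) [Fact (1 ≤ p)] : PiLp p (fun _ : Fin (n + 1) => ℝ) →L[ℝ] ℝ :=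
  (ContinuousLinearMap.proj (0 : Fin (n + 1))).comp
    (PiLp.continuousLinearEquiv p ℝ (fun _ : Fin (n + 1) => ℝ)).toContinuousLinearMap

/-- Projection of a jet onto its gradient components, valued in `ℓ^p(ℝⁿ)`. -/
def projGrad (n : ℕ) (p : ℝ≥0∞) [Fact (1 ≤ p)] :
    PiLp p (fun _ : Fin (n + 1) => ℝ) →L[ℝ] PiLp p (fun _ : Fin n => ℝ) :=
  ((PiLp.continuousLinearEquiv p ℝ (fun _ : Fin n => ℝ)).symm.toContinuousLinearMap).comp
    ((ContinuousLinearMap.pi fun i : Fin n => ContinuousLinearMap.proj (R := ℝ) i.succ).comp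
      (PiLp.continuousLinearEquiv p ℝ (fun _ : Fin (n + 1) => ℝ)).toContinuousLinearMap)

/-- The canonical Sobolev embedding `I : W^{1,p}_0(D) → L^p(D)` (as a map into `L^p(ℝⁿ)`;
all functions in `W^{1,p}_0(D)` vanish a.e. outside `D`). -/
def SobolevEmb {n : ℕ} (p : ℝ≥0∞) [Fact (1 ≤ p)] (D : Set (Fin n → ℝ)) :
    W0sub (n := n) p D →L[ℝ] Lp ℝ p (volume : Measure (Fin n → ℝ)) :=
  ((proj0 n p).compLpL p volume).comp (W0sub p D).subtypeL

/-- The gradient map `W^{1,p}_0(D) → L^p(D; ℓ^p(ℝⁿ))`, `u ↦ ∇u`. -/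
def SobolevGrad {n : ℕ} (p : ℝ≥0∞) [Fact (1 ≤ p)] (D : Set (Fin n → ℝ)) :
    W0sub (n := n) p D →L[ℝ] Lp (PiLp p (fun _ : Fin n => ℝ)) p (volume : Measure (Fin n → ℝ)) :=
  ((projGrad n p).compLpL p volume).comp (W0sub p D).subtypeL

/-- `π_p = 2 ∫₀¹ (1 - sᵖ)^{-1/p} ds`. -/
def piP (p : ℝ) : ℝ := 2 * ∫ s in (0 : ℝ)..1, (1 - s ^ p) ^ (-1 / p)

/-- The inverse of `t ↦ ∫₀ᵗ (1 - sᵖ)^{-1/p} ds` on `[0,1]`; this is `sin_p` on `[0, π_p/2]`. -/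
def sinpHalf (p : ℝ) : ℝ → ℝ :=
  Function.invFunOn (fun t : ℝ => ∫ s in (0 : ℝ)..t, (1 - s ^ p) ^ (-1 / p)) (Set.Icc 0 1)

/-- `sin_p` on `[0, π_p]`, by reflection around `π_p/2`. -/
def sinpBase (p t : ℝ) : ℝ :=
  if t ≤ piP p / 2 then sinpHalf p t else sinpHalf p (piP p - t)

/-- `sin_p` on `[-π_p, π_p]`, by odd reflection. -/
def sinpSym (p t : ℝ) : ℝ := if 0 ≤ t then sinpBase p t else -sinpBase p (-t)

/-- The generalized sine function `sin_p`, extended `2π_p`-periodically to all of `ℝ`. -/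
def sinp (p t : ℝ) : ℝ :=
  sinpSym p (t - 2 * piP p * ⌊(t + piP p) / (2 * piP p)⌋)

/-- The generalized cosine function `cos_p = (sin_p)'`. -/
def cosp (p : ℝ) : ℝ → ℝ := deriv (sinp p)

/-- The `m`-th entropy number of a bounded linear operator: the infimum of all `ε > 0` such
that the image of the closed unit ball can be covered by `2^{m-1}` balls of radius `ε`. -/
def entropyNumber {X Y : Type*} [NormedAddCommGroup X] [NormedSpace ℝ X]
    [NormedAddCommGroup Y] [NormedSpace ℝ Y] (m : ℕ) (T : X →L[ℝ] Y) : ℝ :=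
  sInf {ε : ℝ | 0 < ε ∧ ∃ c : Fin (2 ^ (m - 1)) → Y,
    ∀ x : X, ‖x‖ ≤ 1 → ∃ j, ‖T x - c j‖ ≤ ε}

end

/-- The integrand `(1 - sᵖ)^{-1/p}` of `arcsin_p`, extended by `1` outside `[0, 1)`. -/
noncomputable def arcsinpDensity (p s : ℝ) : ℝ :=
  if s < 1 then (1 - (max s 0) ^ p) ^ (-1 / p) else 1

lemma one_sub_max_rpow_pos {p s : ℝ} (hp : 1 < p) (hs : s < 1) : 0 < 1 - (max s 0) ^ p := by
  have : (max s 0) ^ p < 1 :=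
    Real.rpow_lt_one (le_max_right _ _) (max_lt hs one_pos) (by linarith)
  linarith

lemma one_le_arcsinpDensity {p : ℝ} (hp : 1 < p) (s : ℝ) : 1 ≤ arcsinpDensity p s := by
  unfold arcsinpDensity
  split_ifs with h
  · refine Real.one_le_rpow_of_pos_of_le_one_of_nonpos (one_sub_max_rpow_pos hp h) ?_ ?_
    · have : 0 ≤ (max s 0) ^ p := Real.rpow_nonneg (le_max_right _ _) _
      linarith
    · exact div_nonpos_of_nonpos_of_nonneg (by norm_num) (by linarith)
  · exact le_rfl

lemma measurable_arcsinpDensity (p : ℝ) : Measurable (arcsinpDensity p) := by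
  unfold arcsinpDensity
  refine Measurable.ite (measurableSet_lt measurable_id measurable_const) ?_ measurable_const
  fun_prop

lemma arcsinpDensity_eq {p s : ℝ} (hs : s ∈ Icc (0 : ℝ) 1) (h1 : s ≠ 1) :
    arcsinpDensity p s = (1 - s ^ p) ^ (-1 / p) := by
  unfold arcsinpDensity
  rw [if_pos (lt_of_le_of_ne hs.2 h1), max_eq_left hs.1]

lemma intervalIntegrable_arcsinpDensity_zero_one {p : ℝ} (hp : 1 < p) :
    IntervalIntegrable (arcsinpDensity p) volume 0 1 := by
  have h : IntervalIntegrable (fun s : ℝ => (1 - s) ^ (-1 / p)) volume 0 1 := by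
    have h0 : -1 < -1 / p := by rw [lt_div_iff₀ (by linarith)]; linarith
    have := (intervalIntegral.intervalIntegrable_rpow' (a := 1) (b := 0) h0).comp_sub_left 1
    simpa using this
  refine h.mono_fun (measurable_arcsinpDensity p).aestronglyMeasurable ?_
  rw [Filter.EventuallyLE, ae_restrict_iff' measurableSet_uIoc]
  filter_upwards [Measure.ae_ne volume (1 : ℝ)] with s hs1 hs
  rw [uIoc_of_le zero_le_one] at hs
  have hs' : s < 1 := lt_of_le_of_ne hs.2 hs1
  rw [arcsinpDensity_eq ⟨hs.1.le, hs.2⟩ hs1, Real.norm_of_nonneg, Real.norm_of_nonneg]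
  · refine Real.rpow_le_rpow_of_nonpos (by linarith) ?_ ?_
    · have := Real.rpow_le_rpow_of_exponent_ge hs.1 hs.2 hp.le
      rw [Real.rpow_one] at this
      linarith
    · exact div_nonpos_of_nonpos_of_nonneg (by norm_num) (by linarith)
  · exact Real.rpow_nonneg (by linarith) _
  · refine Real.rpow_nonneg ?_ _
    have := Real.rpow_le_one hs.1.le hs.2 (by linarith : 0 ≤ p)
    linarith

lemma intervalIntegrable_arcsinpDensity {p : ℝ} (hp : 1 < p) (x y : ℝ) :
    IntervalIntegrable (arcsinpDensity p) volume x y := by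
  have hneg : ∀ x : ℝ, x ≤ 0 → IntervalIntegrable (arcsinpDensity p) volume x 0 := fun x hx => by
    refine (intervalIntegrable_const (c := (1 : ℝ))).congr fun s hs => ?_
    rw [uIoc_of_le hx] at hs
    have : s < 1 := hs.2.trans_lt one_pos
    simp [arcsinpDensity, this, max_eq_right hs.2, Real.zero_rpow (by linarith : p ≠ 0)]
  have hpos : ∀ x : ℝ, 1 ≤ x → IntervalIntegrable (arcsinpDensity p) volume 1 x := fun x hx => by
    refine (intervalIntegrable_const (c := (1 : ℝ))).congr fun s hs => ?_
    rw [uIoc_of_le hx] at hs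
    simp [arcsinpDensity, not_lt.2 hs.1.le]
  have key := ((hneg (min x (min y 0)) (by simp)).trans
    (intervalIntegrable_arcsinpDensity_zero_one hp)).trans (hpos (max x (max y 1)) (by simp))
  refine key.mono_set ?_
  have hle : min x (min y 0) ≤ max x (max y 1) := (min_le_left _ _).trans (le_max_left _ _)
  rw [uIcc_of_le hle]
  intro z hz
  rcases mem_uIcc.1 hz with h | h
  · exact ⟨(min_le_left _ _).trans h.1,
      h.2.trans ((le_max_left _ _).trans (le_max_right _ _))⟩
  · exact ⟨((min_le_right _ _).trans (min_le_left _ _)).trans h.1, h.2.trans (le_max_left _ _)⟩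

/-- A continuous strictly increasing function on `ℝ` agreeing with `sin_p` on `[0, π_p / 2]` and
satisfying the differential equation of `sin_p` to the left of `π_p / 2`. -/
lemma exists_sinp_profile {p : ℝ} (hp : 1 < p) :
    ∃ S : ℝ → ℝ, Continuous S ∧ StrictMono S ∧ S 0 = 0 ∧ S (piP p / 2) = 1 ∧
      ∀ t < piP p / 2, HasDerivAt S ((1 - (max (S t) 0) ^ p) ^ (1 / p)) t := by
  set G : ℝ → ℝ := fun x => ∫ s in (0 : ℝ)..x, arcsinpDensity p s with hG
  have hint := intervalIntegrable_arcsinpDensity hp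
  have hsub : ∀ x y, x ≤ y → y - x ≤ G y - G x := fun x y hxy => by
    rw [hG]
    simp only
    rw [intervalIntegral.integral_interval_sub_left (hint _ _) (hint _ _)]
    have := intervalIntegral.integral_mono_on hxy (intervalIntegrable_const (c := (1 : ℝ)))
      (hint x y) (fun s _ => one_le_arcsinpDensity hp s)
    simpa using this
  have hmono : StrictMono G := fun x y hxy => by linarith [hsub x y hxy.le]
  have hcont : Continuous G := intervalIntegral.continuous_primitive hint 0
  have hG0 : G 0 = 0 := by simp [hG]
  have hsurj : Function.Surjective G := by
    refine hcont.surjective (tendsto_atTop_mono' _ ?_ tendsto_id)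
      (tendsto_atBot_mono' _ ?_ tendsto_id)
    · filter_upwards [eventually_ge_atTop 0] with x hx
      have := hsub 0 x hx
      simp only [id]; linarith
    · filter_upwards [eventually_le_atBot 0] with x hx
      have := hsub x 0 hx
      simp only [id]; linarith
  have hG1 : G 1 = piP p / 2 := by
    have : G 1 = ∫ s in (0 : ℝ)..1, (1 - s ^ p) ^ (-1 / p) := by
      refine intervalIntegral.integral_congr_ae ?_
      filter_upwards [Measure.ae_ne volume (1 : ℝ)] with s hs1 hs
      rw [uIoc_of_le zero_le_one] at hs
      exact arcsinpDensity_eq ⟨hs.1.le, hs.2⟩ hs1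
    rw [this, piP]; ring
  let e := hmono.orderIsoOfSurjective G hsurj
  have heG : ∀ x, e x = G x := fun x => rfl
  have hS1 : e.symm (piP p / 2) = 1 := by rw [OrderIso.symm_apply_eq, heG, hG1]
  refine ⟨e.symm, e.symm.continuous, e.symm.strictMono, ?_, hS1, ?_⟩
  · rw [OrderIso.symm_apply_eq, heG, hG0]
  intro t ht
  have hlt : e.symm t < 1 := hS1 ▸ e.symm.strictMono ht
  have hpos := one_sub_max_rpow_pos hp hlt
  have hca : ContinuousAt (arcsinpDensity p) (e.symm t) := by
    have h1 : ContinuousAt (fun s : ℝ => (1 - (max s 0) ^ p) ^ (-1 / p)) (e.symm t) := by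
      refine ContinuousAt.rpow_const ?_ (Or.inl hpos.ne')
      refine continuousAt_const.sub ?_
      exact (continuousAt_id.max continuousAt_const).rpow_const (Or.inr (by linarith))
    refine h1.congr ?_
    filter_upwards [eventually_lt_nhds hlt] with s hs
    simp [arcsinpDensity, hs]
  have hd := intervalIntegral.integral_hasDerivAt_right (hint 0 (e.symm t))
    ((measurable_arcsinpDensity p).stronglyMeasurable.stronglyMeasurableAtFilter) hca
  have := HasDerivAt.of_local_left_inverse (g := e.symm) (a := t)
    e.symm.continuous.continuousAt hd
    (by linarith [one_le_arcsinpDensity hp (e.symm t)])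
    (Eventually.of_forall fun y => e.apply_symm_apply y)
  have hinv : (1 - (max (e.symm t) 0) ^ p) ^ (1 / p) = (arcsinpDensity p (e.symm t))⁻¹ := by
    rw [show arcsinpDensity p (e.symm t) = _ from if_pos hlt, ← Real.rpow_neg hpos.le]
    congr 1; ring
  rw [hinv]
  exact this

lemma piP_pos {p : ℝ} (hp : 1 < p) : 0 < piP p := by
  obtain ⟨S, -, hS, h0, h1, -⟩ := exists_sinp_profile hp
  have : (0 : ℝ) < piP p / 2 := hS.lt_iff_lt.1 (by rw [h0, h1]; exact one_pos)
  linarith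

/-- Poincaré inequality on a half interval, with a Dirichlet condition at one end only. -/
lemma integral_rpow_abs_le_of_half_interval {p M R : ℝ} (hp : 1 < p) (hR0 : 0 < R) (hR : R < M)
    {u u' : ℝ → ℝ} (hu : ∀ t, HasDerivAt u (u' t) t) (hu' : Continuous u') (huR : u R = 0) :
    (p - 1) * (piP p / (2 * M)) ^ p * ∫ t in (0 : ℝ)..R, |u t| ^ p ≤
      ∫ t in (0 : ℝ)..R, |u' t| ^ p := by
  obtain ⟨S, hSc, hSm, hS0, hS1, hSd⟩ := exists_sinp_profile hp
  have hp0 : 0 < p := by linarith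
  have hM : 0 < M := hR0.trans hR
  have hpi := piP_pos hp
  set c := piP p / (2 * M) with hc
  have hc0 : 0 < c := by positivity
  have hcM : c * M = piP p / 2 := by rw [hc]; field_simp
  set q := p / (p - 1) with hq
  have hpq : p.HolderConjugate q := Real.HolderConjugate.conjExponent hp
  have hq0 : 0 < q := hpq.symm.pos
  set s : ℝ → ℝ := fun t => S (piP p / 2 - c * t) with hs
  have hs0 : ∀ t ∈ Icc 0 R, 0 < s t := fun t ht => by
    rw [← hS0]; apply hSm
    have := mul_lt_mul_of_pos_left (ht.2.trans_lt hR) hc0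
    linarith
  have hs1 : ∀ t ∈ Ioc 0 R, s t < 1 := fun t ht => by
    rw [← hS1]; apply hSm
    have := mul_pos hc0 ht.1
    linarith
  have hsz : s 0 = 1 := by simp [hs, hS1]
  have hsc : Continuous s := hSc.comp (by fun_prop)
  have huc : Continuous u := continuous_iff_continuousAt.2 fun t => (hu t).continuousAt
  set K : ℝ → ℝ := fun t => -(c ^ (p - 1) * ((s t) ^ (-p) - 1) ^ (1 / q)) with hK
  have hKc : ContinuousOn K (Icc 0 R) := by
    refine (ContinuousOn.mul continuousOn_const ?_).neg
    refine ContinuousOn.rpow_const ?_ fun t _ => Or.inr (by positivity)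
    refine ContinuousOn.sub ?_ continuousOn_const
    exact hsc.continuousOn.rpow_const fun t ht => Or.inl (hs0 t ht).ne'
  have hKd : ∀ t ∈ Ioo 0 R, HasDerivAt K (-(p - 1) * c ^ p * (s t) ^ (-p)) t := fun t ht => by
    have h0 := hs0 t ⟨ht.1.le, ht.2.le⟩
    have h1 := hs1 t ⟨ht.1, ht.2.le⟩
    have hlt : (s t) ^ p < 1 := Real.rpow_lt_one h0.le h1 hp0
    have hsp : 0 < (s t) ^ p := Real.rpow_pos_of_pos h0 _
    have hds : HasDerivAt s ((1 - (s t) ^ p) ^ (1 / p) * -c) t := by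
      have h2 : HasDerivAt (fun t => piP p / 2 - c * t) (-c) t := by
        simpa using ((hasDerivAt_id t).const_mul c).const_sub (piP p / 2)
      have h3 := hSd (piP p / 2 - c * t) (by have := mul_pos hc0 ht.1; linarith)
      have := h3.comp t h2
      rwa [max_eq_left h0.le] at this
    have hB : 0 < (s t) ^ (-p) - 1 := by
      have := Real.one_lt_rpow_of_pos_of_lt_one_of_neg h0 h1 (by linarith : -p < 0)
      linarith
    have hd := ((((hds.rpow_const (p := -p) (Or.inl h0.ne')).sub_const 1).rpow_const
      (p := 1 / q) (Or.inl hB.ne')).const_mul (c ^ (p - 1))).neg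
    refine hd.congr_deriv ?_
    have e1 : 1 - (s t) ^ p = (s t) ^ p * ((s t) ^ (-p) - 1) := by
      rw [mul_sub, ← Real.rpow_add h0]; simp
    have e2 : (1 : ℝ) / q - 1 = -(1 / p) := by rw [hq]; field_simp; ring
    rw [e1, Real.mul_rpow hsp.le hB.le, e2, ← Real.rpow_mul h0.le, mul_one_div_cancel hp0.ne',
      Real.rpow_one, Real.rpow_neg hB.le, Real.rpow_sub_one h0.ne', Real.rpow_sub_one hc0.ne']
    have := (Real.rpow_pos_of_pos hB (1 / p)).ne'
    have e3 : 1 / q = (p - 1) / p := by rw [hq, one_div_div]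
    rw [e3]
    field_simp
  have hup : Continuous fun t => |u t| ^ p := huc.abs.rpow_const fun _ => Or.inr hp0.le
  have hup' : Continuous fun t => |u' t| ^ p := hu'.abs.rpow_const fun _ => Or.inr hp0.le
  have key := intervalIntegral.sub_le_integral_of_hasDeriv_right_of_le (a := 0) (b := R)
    (g := fun t => K t * |u t| ^ p)
    (g' := fun t => -(p - 1) * c ^ p * (s t) ^ (-p) * |u t| ^ p +
      K t * (p * |u t| ^ (p - 2) * u t * u' t))
    (φ := fun t => |u' t| ^ p - (p - 1) * c ^ p * |u t| ^ p) hR0.le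
    (hKc.mul hup.continuousOn)
    (fun t ht => ((hKd t ht).mul
      ((hasDerivAt_abs_rpow (u t) hp).comp t (hu t))).hasDerivWithinAt)
    (hup'.sub (continuous_const.mul hup)).integrableOn_Icc
    (fun t ht => by
      have h0 := hs0 t ⟨ht.1.le, ht.2.le⟩
      have h1 := hs1 t ⟨ht.1, ht.2.le⟩
      have hB : 0 < (s t) ^ (-p) - 1 := by
        have := Real.one_lt_rpow_of_pos_of_lt_one_of_neg h0 h1 (by linarith : -p < 0)
        linarith
      have hK0 : 0 ≤ -K t := by
        simp only [hK, neg_neg]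
        exact mul_nonneg (Real.rpow_nonneg hc0.le _) (Real.rpow_nonneg hB.le _)
      have hKq : (-K t) ^ q = c ^ p * ((s t) ^ (-p) - 1) := by
        simp only [hK, neg_neg]
        rw [Real.mul_rpow (by positivity) (by positivity), ← Real.rpow_mul hc0.le,
          ← Real.rpow_mul hB.le, one_div_mul_cancel hq0.ne', Real.rpow_one]
        congr 2
        rw [hq]; field_simp [(sub_pos.2 hp).ne']
      have hY := Real.young_inequality_of_nonneg (abs_nonneg (u' t))
        (mul_nonneg (Real.rpow_nonneg (abs_nonneg (u t)) (p - 1)) hK0) hpq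
      rw [Real.mul_rpow (by positivity) hK0, hKq, ← Real.rpow_mul (abs_nonneg _),
        show (p - 1) * q = p by rw [hq]; field_simp [(sub_pos.2 hp).ne']] at hY
      have hle : K t * (p * |u t| ^ (p - 2) * u t * u' t) ≤
          p * (|u' t| * (|u t| ^ (p - 1) * -K t)) := by
        refine (le_abs_self _).trans (le_of_eq ?_)
        have e : |u t| ^ (p - 1) = |u t| ^ (p - 2) * |u t| := by
          rcases eq_or_ne (u t) 0 with h | h
          · simp [h, Real.zero_rpow (sub_pos.2 hp).ne']
          · rw [← Real.rpow_add_one (abs_pos.2 h).ne']; congr 1; ring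
        rw [e, abs_mul, abs_mul, abs_mul, abs_mul, abs_of_nonneg hp0.le,
          abs_of_nonneg (Real.rpow_nonneg (abs_nonneg (u t)) _), ← abs_neg (K t),
          abs_of_nonneg hK0]
        ring
      have hY2 := mul_le_mul_of_nonneg_left hY hp0.le
      have e4 : p * (|u' t| ^ p / p + |u t| ^ p * (c ^ p * ((s t) ^ (-p) - 1)) / q) =
          |u' t| ^ p + (p - 1) * (|u t| ^ p * (c ^ p * ((s t) ^ (-p) - 1))) := by
        rw [hq]; field_simp
      rw [e4] at hY2
      nlinarith [hle, hY2])
  rw [intervalIntegral.integral_sub (hup'.intervalIntegrable _ _)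
    ((hup.const_mul _).intervalIntegrable _ _),
    intervalIntegral.integral_const_mul] at key
  have hK0 : K 0 = 0 := by
    simp [hK, hsz, Real.zero_rpow (inv_pos.2 hq0).ne']
  simp only [hK0, huR, abs_zero, Real.zero_rpow hp0.ne'] at key
  linarith

/-- The sharp one-dimensional Poincaré inequality with Dirichlet boundary conditions. -/
lemma integral_rpow_abs_le_of_tsupport_subset_Ioo {p α β : ℝ} (hp : 1 < p) (hαβ : α < β)
    {u u' : ℝ → ℝ} (hu : ∀ t, HasDerivAt u (u' t) t) (hu' : Continuous u')
    (hcs : HasCompactSupport u) (hsupp : tsupport u ⊆ Ioo α β) :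
    (p - 1) * (piP p / (β - α)) ^ p * ∫ t, |u t| ^ p ≤ ∫ t, |u' t| ^ p := by
  have hp0 : 0 < p := by linarith
  set m := (α + β) / 2 with hm
  set M := (β - α) / 2 with hM
  have hM0 : 0 < M := by rw [hM]; linarith
  obtain ⟨R, hR0, hRM, hR⟩ : ∃ R, 0 < R ∧ R < M ∧ ∀ t ∈ tsupport u, |t - m| < R := by
    obtain ⟨r, hr, hr'⟩ := IsCompact.exists_forall_le' (s := tsupport u)
      (f := fun t => M - |t - m|) (a := 0) hcs (by fun_prop) (fun t ht => by
        have := hsupp ht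
        rw [sub_pos, abs_lt]; constructor <;> linarith [this.1, this.2])
    refine ⟨M - min r M / 2, ?_, ?_, fun t ht => ?_⟩
    · linarith [min_le_right r M]
    · linarith [lt_min hr hM0]
    · linarith [hr' t ht, min_le_left r M, lt_min hr hM0]
  have huz : ∀ t, R ≤ |t| → u (m + t) = 0 := fun t ht => by
    refine image_eq_zero_of_notMem_tsupport fun h => ?_
    have := hR _ h
    rw [add_sub_cancel_left] at this
    linarith
  have huc : Continuous u := continuous_iff_continuousAt.2 fun t => (hu t).continuousAt
  have hup : Continuous fun t => |u (m + t)| ^ p :=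
    (by fun_prop : Continuous fun t => |u (m + t)|).rpow_const fun _ => Or.inr hp0.le
  have hup' : Continuous fun t => |u' (m + t)| ^ p :=
    (by fun_prop : Continuous fun t => |u' (m + t)|).rpow_const fun _ => Or.inr hp0.le
  have hu'cs : HasCompactSupport u' := by
    have : u' = deriv u := funext fun t => (hu t).deriv.symm
    rw [this]; exact hcs.deriv
  have hint' : Integrable fun t => |u' t| ^ p := by
    refine Continuous.integrable_of_hasCompactSupport
      (hu'.abs.rpow_const fun _ => Or.inr hp0.le) ?_
    exact hu'cs.comp_left (g := fun x => |x| ^ p) (by simp [Real.zero_rpow hp0.ne'])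
  have h1 := integral_rpow_abs_le_of_half_interval hp hR0 hRM (u := fun t => u (m + t))
    (fun t => (hu (m + t)).comp_const_add m t) (by fun_prop) (huz R (le_abs_self R))
  have h2 := integral_rpow_abs_le_of_half_interval hp hR0 hRM (u := fun t => u (m + -t))
    (u' := fun t => -u' (m + -t))
    (fun t => (((hu (m + -t)).comp_const_add m (-t)).comp t (hasDerivAt_neg t)).congr_deriv
      (by ring))
    (by fun_prop) (huz (-R) (by rw [abs_neg]; exact le_abs_self R))
  simp only [abs_neg] at h2
  have hsplit : ∀ F : ℝ → ℝ, Continuous F →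
      ∫ t in (-R)..R, F t = (∫ t in (0 : ℝ)..R, F t) + ∫ t in (0 : ℝ)..R, F (-t) := fun F hF => by
    rw [intervalIntegral.integral_comp_neg, neg_zero, add_comm,
      intervalIntegral.integral_add_adjacent_intervals (hF.intervalIntegrable _ _)
      (hF.intervalIntegrable _ _)]
  have e1 : ∫ t, |u t| ^ p = ∫ t in (-R)..R, |u (m + t)| ^ p := by
    rw [← integral_add_left_eq_self _ m, intervalIntegral.integral_eq_integral_of_support_subset]
    intro t ht
    have ht' : ¬ R ≤ |t| := fun h => ht (by simp [huz t h, Real.zero_rpow hp0.ne'])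
    rw [not_le, abs_lt] at ht'
    exact ⟨ht'.1, ht'.2.le⟩
  have e2 : ∫ t in (-R)..R, |u' (m + t)| ^ p ≤ ∫ t, |u' t| ^ p := by
    rw [← integral_add_left_eq_self _ m,
      intervalIntegral.integral_of_le (by linarith : -R ≤ R)]
    exact setIntegral_le_integral (hint'.comp_add_left m)
      (Eventually.of_forall fun t => Real.rpow_nonneg (abs_nonneg _) _)
  rw [hsplit _ hup'] at e2
  rw [e1, hsplit _ hup]
  have h2M : 2 * M = β - α := by rw [hM]; ring
  rw [h2M] at h1 h2
  linarith

lemma hasDerivAt_max_zero_rpow {ε : ℝ} (hε : 0 < ε) (x : ℝ) :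
    HasDerivAt (fun x : ℝ => (max x 0) ^ (1 + ε)) ((1 + ε) * (max x 0) ^ ε) x := by
  refine hasDerivAt_of_hasDerivAt_of_ne' (g := fun x : ℝ => (1 + ε) * (max x 0) ^ ε)
    (x := 0) (fun y hy => ?_) ?_ ?_ x
  · rcases lt_or_gt_of_ne hy with h | h
    · have : HasDerivAt (fun _ : ℝ => (0 : ℝ)) ((1 + ε) * (max y 0) ^ ε) y := by
        rw [max_eq_right h.le, Real.zero_rpow hε.ne', mul_zero]; exact hasDerivAt_const _ _
      refine this.congr_of_eventuallyEq ?_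
      filter_upwards [eventually_lt_nhds h] with z hz
      rw [max_eq_right hz.le, Real.zero_rpow (by linarith)]
    · have := Real.hasDerivAt_rpow_const (x := y) (p := 1 + ε) (Or.inl h.ne')
      rw [add_sub_cancel_left] at this
      rw [max_eq_left h.le]
      refine this.congr_of_eventuallyEq ?_
      filter_upwards [eventually_gt_nhds h] with z hz
      rw [max_eq_left hz.le]
  · exact (Continuous.rpow_const (by fun_prop) fun _ => Or.inr (by linarith)).continuousAt
  · exact (continuous_const.mul
      (Continuous.rpow_const (by fun_prop) fun _ => Or.inr hε.le)).continuousAt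

/-- A power `> 1` of the first eigenfunction of the one-dimensional `p`-Laplacian is continuously
differentiable on `ℝ`, and its Rayleigh quotient is explicit. -/
lemma exists_hasDerivAt_integral_rpow_abs_eq {p M ε : ℝ} (hp : 1 < p) (hM : 0 < M) (hε : 0 < ε) :
    ∃ V f : ℝ → ℝ, (∀ t, HasDerivAt V (f t) t) ∧ Continuous f ∧ (∀ t, M ≤ |t| → V t = 0) ∧
      (∀ t, M ≤ |t| → f t = 0) ∧ 0 < ∫ t, |V t| ^ p ∧
      ∫ t, |f t| ^ p =
        (p - 1) * (piP p / (2 * M)) ^ p * ((1 + ε) ^ p / (1 + ε * p)) * ∫ t, |V t| ^ p := by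
  obtain ⟨S, hSc, hSm, hS0, hS1, hSd⟩ := exists_sinp_profile hp
  have hp0 : 0 < p := by linarith
  have hpi := piP_pos hp
  set c := piP p / (2 * M) with hc
  have hc0 : 0 < c := by positivity
  have hcM : c * M = piP p / 2 := by rw [hc]; field_simp
  set s : ℝ → ℝ := fun t => S (piP p / 2 - c * t) with hs
  have hs_anti : StrictAnti s := fun x y hxy => hSm (by
    have := mul_lt_mul_of_pos_left hxy hc0
    linarith)
  have hsz : s 0 = 1 := by simp [hs, hS1]
  have hsM : s M = 0 := by simp [hs, hcM, hS0]
  have hsc : Continuous s := hSc.comp (by fun_prop)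
  have hsd : ∀ t, 0 < t → HasDerivAt s ((1 - (max (s t) 0) ^ p) ^ (1 / p) * -c) t := fun t ht => by
    have h2 : HasDerivAt (fun t => piP p / 2 - c * t) (-c) t := by
      simpa using ((hasDerivAt_id t).const_mul c).const_sub (piP p / 2)
    exact (hSd (piP p / 2 - c * t) (by have := mul_pos hc0 ht; linarith)).comp t h2
  set h : ℝ → ℝ := fun t =>
    (1 + ε) * (max (s t) 0) ^ ε * ((1 - (max (s t) 0) ^ p) ^ (1 / p) * c) with hh
  have hmc : ∀ r : ℝ, 0 < r → Continuous fun t => (max (s t) 0) ^ r := fun r hr =>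
    (hsc.max continuous_const).rpow_const fun _ => Or.inr hr.le
  have hhc : Continuous h := (continuous_const.mul (hmc ε hε)).mul
    (((continuous_const.sub (hmc p hp0)).rpow_const fun _ => Or.inr (by positivity)).mul_const _)
  have hh0 : h 0 = 0 := by
    simp [hh, hsz, Real.zero_rpow (inv_pos.2 hp0).ne']
  set V : ℝ → ℝ := fun t => (max (s |t|) 0) ^ (1 + ε) with hV
  set f : ℝ → ℝ := fun t => if t ≤ 0 then h (-t) else -h t with hf
  have hVc : Continuous V := (hmc (1 + ε) (by linarith)).comp continuous_abs
  have hfc : Continuous f := by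
    refine Continuous.if_le (by fun_prop) (by fun_prop) continuous_id continuous_const ?_
    rintro t rfl
    simp [hh0]
  have hVpos : ∀ t, 0 < t → HasDerivAt (fun t => (max (s t) 0) ^ (1 + ε)) (-h t) t :=
    fun t ht => by
      refine ((hasDerivAt_max_zero_rpow hε (s t)).comp t (hsd t ht)).congr_deriv ?_
      rw [hh]; ring
  have hVd : ∀ t, HasDerivAt V (f t) t := by
    refine hasDerivAt_of_hasDerivAt_of_ne' (x := 0) (fun t ht => ?_)
      hVc.continuousAt hfc.continuousAt
    rcases lt_or_gt_of_ne ht with h' | h'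
    · have := (hVpos (-t) (by linarith)).comp t (hasDerivAt_neg t)
      refine (this.congr_of_eventuallyEq ?_).congr_deriv ?_
      · filter_upwards [eventually_lt_nhds h'] with z hz
        simp [hV, abs_of_neg hz]
      · simp [hf, h'.le]
    · refine ((hVpos t h').congr_of_eventuallyEq ?_).congr_deriv ?_
      · filter_upwards [eventually_gt_nhds h'] with z hz
        simp [hV, abs_of_pos hz]
      · simp [hf, not_le.2 h']
  have hsneg : ∀ t, M ≤ t → max (s t) 0 = 0 := fun t ht =>
    max_eq_right (hsM ▸ hs_anti.antitone ht)
  have hVz : ∀ t, M ≤ |t| → V t = 0 := fun t ht => by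
    simp only [hV, hsneg _ ht]
    exact Real.zero_rpow (by linarith)
  have hhz : ∀ t, M ≤ t → h t = 0 := fun t ht => by
    simp [hh, hsneg t ht, Real.zero_rpow hε.ne']
  have hfz : ∀ t, M ≤ |t| → f t = 0 := fun t ht => by
    rcases le_or_gt t 0 with h' | h'
    · simp [hf, h', hhz (-t) (abs_of_nonpos h' ▸ ht)]
    · simp [hf, not_le.2 h', hhz t (abs_of_pos h' ▸ ht)]
  have hcut : ∀ F : ℝ → ℝ, (∀ t, M ≤ t → F t = 0) →
      ∫ t in Ioi 0, F t = ∫ t in Ioc 0 M, F t := fun F hF => by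
    refine (setIntegral_eq_of_subset_of_forall_sdiff_eq_zero measurableSet_Ioi
      Ioc_subset_Ioi_self fun t ht => hF t ?_)
    by_contra hlt
    exact ht.2 ⟨ht.1, (not_le.1 hlt).le⟩
  have hVI : ∫ t, |V t| ^ p = 2 * ∫ t in (0 : ℝ)..M, (s t) ^ (ε * p + p) := by
    rw [intervalIntegral.integral_of_le hM.le,
      integral_comp_abs (f := fun t => |(max (s t) 0) ^ (1 + ε)| ^ p)]
    congr 1
    rw [hcut (fun t => |(max (s t) 0) ^ (1 + ε)| ^ p) fun t ht => by
      simp [hsneg t ht, Real.zero_rpow (by linarith : 1 + ε ≠ 0), Real.zero_rpow hp0.ne']]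
    refine setIntegral_congr_fun measurableSet_Ioc fun t ht => ?_
    have h0 : 0 ≤ s t := hsM ▸ hs_anti.antitone ht.2
    rw [max_eq_left h0, abs_of_nonneg (Real.rpow_nonneg h0 _), ← Real.rpow_mul h0]
    congr 1; ring
  have hfI : ∫ t, |f t| ^ p =
      2 * (c ^ p * (1 + ε) ^ p * ∫ t in (0 : ℝ)..M, (s t) ^ (ε * p) * (1 - (s t) ^ p)) := by
    have e : ∀ t, |f t| ^ p = |h (|t|)| ^ p := fun t => by
      rcases le_or_gt t 0 with h' | h'
      · simp [hf, h', abs_of_nonpos h']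
      · simp [hf, not_le.2 h', abs_of_pos h']
    simp_rw [e]
    rw [intervalIntegral.integral_of_le hM.le, integral_comp_abs (f := fun t => |h t| ^ p)]
    congr 1
    rw [hcut (fun t => |h t| ^ p) fun t ht => by
      simp [hhz t ht, Real.zero_rpow hp0.ne'],
      ← integral_const_mul]
    refine setIntegral_congr_fun measurableSet_Ioc fun t ht => ?_
    have h0 : 0 ≤ s t := hsM ▸ hs_anti.antitone ht.2
    have h1 : s t ≤ 1 := hsz ▸ hs_anti.antitone ht.1.le
    have h2 : 0 ≤ 1 - (s t) ^ p := sub_nonneg.2 (Real.rpow_le_one h0 h1 hp0.le)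
    have h3 : 0 ≤ 1 + ε := by linarith
    simp only [hh]
    rw [max_eq_left h0, abs_of_nonneg (by positivity), Real.mul_rpow (by positivity)
      (by positivity), Real.mul_rpow h3 (by positivity), Real.mul_rpow (by positivity) hc0.le,
      ← Real.rpow_mul h0, ← Real.rpow_mul h2, one_div_mul_cancel hp0.ne', Real.rpow_one]
    ring
  have hα : 0 < ε * p := by positivity
  have hAc : Continuous fun t => (s t) ^ (ε * p) * (1 - (s t) ^ p) :=
    (hsc.rpow_const fun _ => Or.inr hα.le).mul
      (continuous_const.sub (hsc.rpow_const fun _ => Or.inr hp0.le))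
  have hBc : Continuous fun t => (s t) ^ (ε * p + p) :=
    hsc.rpow_const fun _ => Or.inr (by positivity)
  have hFTC := intervalIntegral.integral_eq_sub_of_hasDerivAt_of_le (a := 0) (b := M)
    (f := fun t => (s t) ^ (1 + ε * p) * (1 - (s t) ^ p) ^ ((p - 1) / p))
    (f' := fun t => -c * ((1 + ε * p) * ((s t) ^ (ε * p) * (1 - (s t) ^ p)) -
      (p - 1) * (s t) ^ (ε * p + p))) hM.le
    (((hsc.rpow_const fun _ => Or.inr (by positivity)).mul
      ((continuous_const.sub (hsc.rpow_const fun _ => Or.inr hp0.le)).rpow_const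
        fun _ => Or.inr (div_nonneg (by linarith) hp0.le))).continuousOn)
    (fun t ht => by
      have h0 : 0 < s t := hsM ▸ hs_anti ht.2
      have h1 : s t < 1 := hsz ▸ hs_anti ht.1
      have h2 : 0 < 1 - (s t) ^ p := sub_pos.2 (Real.rpow_lt_one h0.le h1 hp0)
      have hd := hsd t ht.1
      rw [max_eq_left h0.le] at hd
      refine ((hd.rpow_const (p := 1 + ε * p) (Or.inl h0.ne')).mul
        (((hd.rpow_const (p := p) (Or.inl h0.ne')).const_sub 1).rpow_const
          (p := (p - 1) / p) (Or.inl h2.ne'))).congr_deriv ?_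
      have e1 : (p - 1) / p = 1 - 1 / p := by field_simp
      have e2 : (p - 1) / p - 1 = -(1 / p) := by field_simp; ring
      have h3 := Real.rpow_pos_of_pos h2 (1 / p)
      rw [e2, Real.rpow_neg h2.le, e1, Real.rpow_sub h2, Real.rpow_one, add_sub_cancel_left,
        Real.rpow_add h0, Real.rpow_add h0, Real.rpow_one, Real.rpow_sub_one h0.ne']
      field_simp
      ring)
    (Continuous.intervalIntegrable (continuous_const.mul
      ((continuous_const.mul hAc).sub (continuous_const.mul hBc))) _ _)
  rw [intervalIntegral.integral_const_mul, intervalIntegral.integral_sub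
    ((hAc.const_mul _).intervalIntegrable _ _) ((hBc.const_mul _).intervalIntegrable _ _),
    intervalIntegral.integral_const_mul, intervalIntegral.integral_const_mul] at hFTC
  simp only [hsM, hsz, Real.zero_rpow (by positivity : 1 + ε * p ≠ 0), Real.one_rpow, sub_self,
    Real.zero_rpow (div_pos (sub_pos.2 hp) hp0).ne', mul_zero, zero_mul, mul_eq_zero, neg_eq_zero,
    hc0.ne', false_or] at hFTC
  have hBpos : 0 < ∫ t in (0 : ℝ)..M, (s t) ^ (ε * p + p) := by
    refine intervalIntegral.intervalIntegral_pos_of_pos_on (hBc.intervalIntegrable _ _)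
      (fun t ht => ?_) hM
    exact Real.rpow_pos_of_pos (hsM ▸ hs_anti ht.2) _
  refine ⟨V, f, hVd, hfc, hVz, hfz, by rw [hVI]; positivity, ?_⟩
  rw [hfI, hVI]
  have : ∫ t in (0 : ℝ)..M, (s t) ^ (ε * p) * (1 - (s t) ^ p) =
      (p - 1) * (∫ t in (0 : ℝ)..M, (s t) ^ (ε * p + p)) / (1 + ε * p) := by
    rw [_root_.eq_div_iff (by positivity)]; linarith
  rw [this]
  field_simp

section Mollification

open scoped Convolution ContDiff

lemma ContDiffBump.convolution_eq_zero_of_le {φ : ContDiffBump (0 : ℝ)} {g : ℝ → ℝ}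
    (hg : Continuous g) {m R t : ℝ} (hgR : ∀ t, R ≤ |t - m| → g t = 0)
    (ht : R + φ.rOut ≤ |t - m|) :
    (φ.normed volume ⋆[ContinuousLinearMap.lsmul ℝ ℝ, volume] g) t = 0 := by
  have := dist_convolution_le (μ := volume) (f := φ.normed volume) (g := g) (x₀ := t) (z₀ := 0)
    (R := φ.rOut) le_rfl (φ.support_normed_eq (μ := volume)).subset φ.nonneg_normed
    φ.integral_normed hg.aestronglyMeasurable (fun x hx => by
      rw [hgR x, dist_self]
      rw [Metric.mem_ball, Real.dist_eq] at hx
      have := abs_sub_le t x m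
      rw [abs_sub_comm t x] at this
      linarith)
  exact dist_le_zero.1 this

lemma tendsto_integral_rpow_abs_bump_convolution {p : ℝ} (hp : 0 < p) {g : ℝ → ℝ}
    (hg : Continuous g) {m R : ℝ} (hgR : ∀ t, R ≤ |t - m| → g t = 0)
    {φ : ℕ → ContDiffBump (0 : ℝ)} (hφ : Tendsto (fun k => (φ k).rOut) atTop (𝓝 0)) :
    Tendsto (fun k => ∫ t,
      |((φ k).normed volume ⋆[ContinuousLinearMap.lsmul ℝ ℝ, volume] g) t| ^ p)
      atTop (𝓝 (∫ t, |g t| ^ p)) := by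
  have hcs : HasCompactSupport g := by
    refine HasCompactSupport.intro (isCompact_Icc (a := m - R) (b := m + R)) fun t ht => hgR t ?_
    by_contra hlt
    rw [not_le, abs_lt] at hlt
    exact ht ⟨by linarith, by linarith⟩
  obtain ⟨C, hC⟩ := hcs.exists_bound_of_continuous hg
  have hC0 : 0 ≤ C := (norm_nonneg _).trans (hC 0)
  refine tendsto_integral_filter_of_dominated_convergence
    ((Icc (m - (R + 1)) (m + (R + 1))).indicator fun _ => C ^ p) ?_ ?_ ?_ ?_
  · refine Eventually.of_forall fun k => Continuous.aestronglyMeasurable ?_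
    refine Continuous.rpow_const (Continuous.abs ?_) fun _ => Or.inr hp.le
    exact (φ k).hasCompactSupport_normed.continuous_convolution_left _
      (φ k).continuous_normed hg.locallyIntegrable
  · filter_upwards [hφ.eventually_lt_const one_pos] with k hk
    refine Eventually.of_forall fun t => ?_
    rw [Real.norm_of_nonneg (Real.rpow_nonneg (abs_nonneg _) _)]
    by_cases ht : t ∈ Icc (m - (R + 1)) (m + (R + 1))
    · rw [indicator_of_mem ht]
      refine Real.rpow_le_rpow (abs_nonneg _) ?_ hp.le
      have := dist_convolution_le (μ := volume) (f := (φ k).normed volume) (g := g) (x₀ := t)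
        (z₀ := 0) (R := (φ k).rOut) hC0 ((φ k).support_normed_eq (μ := volume)).subset
        (φ k).nonneg_normed (φ k).integral_normed hg.aestronglyMeasurable
        (fun x _ => by simpa using hC x)
      simpa using this
    · rw [indicator_of_notMem ht, ContDiffBump.convolution_eq_zero_of_le hg hgR]
      · simp [Real.zero_rpow hp.ne']
      · by_contra hlt
        rw [not_le, abs_lt] at hlt
        exact ht ⟨by linarith, by linarith⟩
  · rw [integrable_indicator_iff measurableSet_Icc]
    exact continuous_const.integrableOn_Icc
  · refine Eventually.of_forall fun t => ?_
    exact ((ContDiffBump.convolution_tendsto_right_of_continuous hφ hg t).abs).rpow_const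
      (Or.inr hp.le)

/-- Sharpness of the one-dimensional Poincaré inequality for test functions. -/
lemma exists_contDiff_integral_rpow_abs_deriv_le {p α β δ : ℝ} (hp : 1 < p) (hαβ : α < β)
    (hδ : 0 < δ) :
    ∃ u : ℝ → ℝ, ContDiff ℝ ∞ u ∧ HasCompactSupport u ∧ tsupport u ⊆ Ioo α β ∧
      0 < ∫ t, |u t| ^ p ∧
      ∫ t, |deriv u t| ^ p ≤ ((p - 1) * (piP p / (β - α)) ^ p + δ) * ∫ t, |u t| ^ p := by
  have hp0 : 0 < p := by linarith
  have hpi := piP_pos hp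
  have hL : 0 < β - α := by linarith
  obtain ⟨ε, hε, hεδ⟩ : ∃ ε : ℝ, 0 < ε ∧
      (p - 1) * (piP p / (2 * ((β - α) / (2 * (1 + ε))))) ^ p * ((1 + ε) ^ p / (1 + ε * p)) <
        (p - 1) * (piP p / (β - α)) ^ p + δ := by
    have hc : ContinuousAt (fun ε : ℝ => (p - 1) * (piP p / (2 * ((β - α) / (2 * (1 + ε))))) ^ p *
        ((1 + ε) ^ p / (1 + ε * p))) 0 := by
      refine ContinuousAt.mul (continuousAt_const.mul (ContinuousAt.rpow_const ?_ (Or.inr hp0.le)))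
        (ContinuousAt.div (ContinuousAt.rpow_const (by fun_prop) (Or.inr hp0.le)) (by fun_prop)
          (by norm_num))
      refine continuousAt_const.div (continuousAt_const.mul
        (continuousAt_const.div (by fun_prop) (by norm_num))) ?_
      simp only [add_zero, mul_one]
      positivity
    have hlt : (p - 1) * (piP p / (2 * ((β - α) / (2 * (1 + (0 : ℝ)))))) ^ p *
        ((1 + (0 : ℝ)) ^ p / (1 + 0 * p)) < (p - 1) * (piP p / (β - α)) ^ p + δ := by
      have e : 2 * ((β - α) / (2 * (1 + (0 : ℝ)))) = β - α := by ring
      rw [e]; simp [hδ]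
    have := hc.eventually_lt_const hlt
    obtain ⟨ε, h1, h2⟩ := ((this.filter_mono nhdsWithin_le_nhds).and
      (self_mem_nhdsWithin : Ioi (0 : ℝ) ∈ 𝓝[>] 0)).exists
    exact ⟨ε, h2, h1⟩
  set M := (β - α) / (2 * (1 + ε)) with hM
  have hM0 : 0 < M := by positivity
  have hML : M < (β - α) / 2 := by
    rw [hM]
    exact div_lt_div_of_pos_left hL two_pos (by linarith)
  obtain ⟨V, f, hVd, hfc, hVz, hfz, hVpos, hVf⟩ :=
    exists_hasDerivAt_integral_rpow_abs_eq hp hM0 hε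
  set m := (α + β) / 2 with hm
  have hWd : ∀ t, HasDerivAt (fun t => V (t - m)) (f (t - m)) t := fun t =>
    (hVd (t - m)).comp_sub_const t m
  have hVc : Continuous V := continuous_iff_continuousAt.2 fun t => (hVd t).continuousAt
  have hWc : Continuous fun t => V (t - m) := by fun_prop
  have hfc' : Continuous fun t => f (t - m) := by fun_prop
  have hderiv : deriv (fun t => V (t - m)) = fun t => f (t - m) := funext fun t => (hWd t).deriv
  have hW1 : ContDiff ℝ 1 fun t => V (t - m) := by
    rw [contDiff_one_iff_deriv]
    exact ⟨fun t => (hWd t).differentiableAt, by rwa [hderiv]⟩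
  have hWcs : HasCompactSupport fun t => V (t - m) := by
    refine HasCompactSupport.intro (isCompact_Icc (a := m - M) (b := m + M))
      fun t ht => hVz _ ?_
    by_contra hlt
    rw [not_le, abs_lt] at hlt
    exact ht ⟨by linarith, by linarith⟩
  let φ : ℕ → ContDiffBump (0 : ℝ) := fun k =>
    ⟨1 / ((k : ℝ) + 1), 2 * (1 / ((k : ℝ) + 1)), by positivity, by
      have : 0 < 1 / ((k : ℝ) + 1) := by positivity
      linarith⟩
  have hφ : Tendsto (fun k => (φ k).rOut) atTop (𝓝 0) := by
    have := (tendsto_one_div_add_atTop_nhds_zero_nat (𝕜 := ℝ)).const_mul 2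
    rwa [mul_zero] at this
  have hd : ∀ k, deriv ((φ k).normed volume ⋆[ContinuousLinearMap.lsmul ℝ ℝ, volume]
      fun t => V (t - m)) = ((φ k).normed volume ⋆[ContinuousLinearMap.lsmul ℝ ℝ, volume]
      fun t => f (t - m)) := fun k => by
    funext t
    rw [← hderiv]
    exact (hWcs.hasDerivAt_convolution_right (ContinuousLinearMap.lsmul ℝ ℝ)
      ((φ k).continuous_normed (μ := volume)).locallyIntegrable hW1 t).deriv
  have hlim1 := tendsto_integral_rpow_abs_bump_convolution hp0 hWc (m := m) (R := M)
    (fun t ht => hVz _ ht) hφ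
  have hlim2 := tendsto_integral_rpow_abs_bump_convolution hp0 hfc' (m := m) (R := M)
    (fun t ht => hfz _ ht) hφ
  have e1 : ∫ t, |V (t - m)| ^ p = ∫ t, |V t| ^ p :=
    integral_sub_right_eq_self (fun t => |V t| ^ p) m
  have e2 : ∫ t, |f (t - m)| ^ p = ∫ t, |f t| ^ p :=
    integral_sub_right_eq_self (fun t => |f t| ^ p) m
  rw [e1] at hlim1
  rw [e2, hVf] at hlim2
  have hev := hlim2.eventually_lt (hlim1.const_mul ((p - 1) * (piP p / (β - α)) ^ p + δ))
    (mul_lt_mul_of_pos_right hεδ hVpos)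
  obtain ⟨k, hk1, hk2, hk3⟩ := (hev.and ((hlim1.eventually_const_lt hVpos).and
    (hφ.eventually_lt_const (sub_pos.2 hML)))).exists
  have hsub : tsupport ((φ k).normed volume ⋆[ContinuousLinearMap.lsmul ℝ ℝ, volume]
      fun t => V (t - m)) ⊆ Icc (m - (M + (φ k).rOut)) (m + (M + (φ k).rOut)) := by
    refine closure_minimal (fun t ht => ?_) isClosed_Icc
    by_contra hlt
    refine ht (ContDiffBump.convolution_eq_zero_of_le hWc (m := m) (R := M)
      (fun t ht => hVz _ ht) ?_)
    by_contra hlt'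
    rw [not_le, abs_lt] at hlt'
    exact hlt ⟨by linarith, by linarith⟩
  refine ⟨_, (φ k).hasCompactSupport_normed.contDiff_convolution_left
    (ContinuousLinearMap.lsmul ℝ ℝ) (φ k).contDiff_normed hWc.locallyIntegrable,
    isCompact_Icc.of_isClosed_subset (isClosed_tsupport _) hsub, hsub.trans fun t ht => ?_,
    hk2, ?_⟩
  · constructor <;> linarith [ht.1, ht.2]
  · rw [hd]
    exact hk1.le

end Mollification

section TestFunctions

open scoped ContDiff

variable {n : ℕ} {D : Set (Fin n → ℝ)} {u : (Fin n → ℝ) → ℝ}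

lemma IsTestFun.continuous_pder (hu : IsTestFun D u) (i : Fin n) : Continuous (pder i u) :=
  (hu.1.continuous_fderiv (by simp)).clm_apply continuous_const

lemma support_pder_subset (i : Fin n) : Function.support (pder i u) ⊆ tsupport u := fun x hx => by
  refine support_fderiv_subset ℝ fun h => hx ?_
  rw [pder, h]
  rfl

lemma IsTestFun.hasCompactSupport_pder (hu : IsTestFun D u) (i : Fin n) :
    HasCompactSupport (pder i u) :=
  hu.2.1.mono' (support_pder_subset i)

lemma Continuous.integrable_rpow_abs_of_hasCompactSupport {p : ℝ} (hp : 0 < p)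
    {g : (Fin n → ℝ) → ℝ} (hg : Continuous g) (hgs : HasCompactSupport g) :
    Integrable fun x => |g x| ^ p :=
  (hg.abs.rpow_const fun _ => Or.inr hp.le).integrable_of_hasCompactSupport
    (hgs.comp_left (g := fun x => |x| ^ p) (by simp [Real.zero_rpow hp.ne']))

lemma IsTestFun.memLp_jet (hu : IsTestFun D u) (p : ℝ≥0∞) [Fact (1 ≤ p)] :
    MemLp (jet p u) p volume := by
  refine Continuous.memLp_of_hasCompactSupport ?_ ?_
  · refine (PiLp.continuous_toLp p _).comp (continuous_pi fun j => ?_)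
    refine Fin.cases hu.1.continuous (fun i => hu.continuous_pder i) j
  · refine hu.2.1.mono' fun x hx => ?_
    by_contra hxu
    refine hx ?_
    ext j
    refine Fin.cases ?_ (fun i => ?_) j
    · exact (image_eq_zero_of_notMem_tsupport hxu : u x = 0)
    · by_contra h
      exact hxu (support_pder_subset i h)

lemma Lp_norm_rpow_eq_integral {α E : Type*} [MeasurableSpace α] {μ : Measure α}
    [NormedAddCommGroup E] {p : ℝ} (hp : 0 < p) (f : Lp E (ENNReal.ofReal p) μ) {g : α → E}
    (hfg : f =ᵐ[μ] g) : ‖f‖ ^ p = ∫ x, ‖g x‖ ^ p ∂μ := by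
  have hp' : ENNReal.ofReal p ≠ 0 := by simpa using hp
  rw [Lp.norm_def, eLpNorm_congr_ae hfg, MemLp.eLpNorm_eq_integral_rpow_norm hp'
    ENNReal.ofReal_ne_top ((memLp_congr_ae hfg).1 (Lp.memLp f)), ENNReal.toReal_ofReal hp.le,
    ENNReal.toReal_ofReal (by positivity), ← Real.rpow_mul (by positivity),
    inv_mul_cancel₀ hp.ne', Real.rpow_one]

lemma norm_rpow_eq_of_ae_eq_jet {p : ℝ} (hp : 0 < p) [Fact (1 ≤ ENNReal.ofReal p)]
    (hu : IsTestFun D u) (f : Vsp n (ENNReal.ofReal p)) (hf : f =ᵐ[volume] jet _ u) :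
    ‖f‖ ^ p = (∫ x, |u x| ^ p) + ∑ i, ∫ x, |pder i u x| ^ p := by
  have hpt : (ENNReal.ofReal p).toReal = p := ENNReal.toReal_ofReal hp.le
  have e : ∀ x, ‖jet (ENNReal.ofReal p) u x‖ ^ p = |u x| ^ p + ∑ i, |pder i u x| ^ p := fun x => by
    rw [PiLp.norm_eq_sum (by rw [hpt]; exact hp), hpt, ← Real.rpow_mul (by positivity),
      one_div_mul_cancel hp.ne', Real.rpow_one, Fin.sum_univ_succ]
    rfl
  have hi := fun i => (hu.continuous_pder i).integrable_rpow_abs_of_hasCompactSupport hp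
    (hu.hasCompactSupport_pder i)
  rw [Lp_norm_rpow_eq_integral hp f hf, integral_congr_ae (Eventually.of_forall e),
    integral_add (hu.1.continuous.integrable_rpow_abs_of_hasCompactSupport hp hu.2.1)
      (integrable_finsetSum _ fun i _ => hi i), integral_finsetSum _ fun i _ => hi i]

lemma norm_proj0_rpow_eq_of_ae_eq_jet {p : ℝ} (hp : 0 < p) [Fact (1 ≤ ENNReal.ofReal p)]
    (f : Vsp n (ENNReal.ofReal p)) (hf : f =ᵐ[volume] jet _ u) :
    ‖(proj0 n (ENNReal.ofReal p)).compLpL (ENNReal.ofReal p) volume f‖ ^ p =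
      ∫ x, |u x| ^ p := by
  refine Lp_norm_rpow_eq_integral hp _ (g := u) ?_
  filter_upwards [(proj0 n (ENNReal.ofReal p)).coeFn_compLpL f, hf] with x h1 h2
  rw [h1, h2]
  rfl

/-- Before closure, every element of the span defining `W0sub` is the jet of a test function. -/
lemma exists_isTestFun_of_mem_span {p : ℝ≥0∞} [Fact (1 ≤ p)] {f : Vsp n p}
    (hf : f ∈ Submodule.span ℝ {f : Vsp n p | ∃ u, IsTestFun D u ∧ f =ᵐ[volume] jet p u}) :
    ∃ u, IsTestFun D u ∧ f =ᵐ[volume] jet p u := by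
  induction hf using Submodule.span_induction with
  | mem f hf => exact hf
  | zero =>
    refine ⟨0, ⟨contDiff_const, HasCompactSupport.zero, by simp [tsupport]⟩, ?_⟩
    filter_upwards [Lp.coeFn_zero (PiLp p fun _ : Fin (n + 1) => ℝ) p
      (volume : Measure (Fin n → ℝ))] with x hx
    rw [hx]
    ext j
    refine Fin.cases rfl (fun i => ?_) j
    simp [jet, pder]
  | add f g _ _ hf hg =>
    obtain ⟨u, hu, hfu⟩ := hf
    obtain ⟨v, hv, hgv⟩ := hg
    refine ⟨u + v, ⟨hu.1.add hv.1, hu.2.1.add hv.2.1,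
      (tsupport_add u v).trans (union_subset hu.2.2 hv.2.2)⟩, ?_⟩
    filter_upwards [Lp.coeFn_add f g, hfu, hgv] with x hx h1 h2
    rw [hx, Pi.add_apply, h1, h2]
    ext j
    refine Fin.cases rfl (fun i => ?_) j
    have := fderiv_add (hu.1.differentiable (by simp) x) (hv.1.differentiable (by simp) x)
    simp [jet, pder, this]
  | smul c f _ hf =>
    obtain ⟨u, hu, hfu⟩ := hf
    refine ⟨c • u, ⟨hu.1.const_smul c, hu.2.1.mono (Function.support_const_smul_subset c u),
      (closure_mono (Function.support_const_smul_subset c u)).trans hu.2.2⟩, ?_⟩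
    filter_upwards [Lp.coeFn_smul c f, hfu] with x hx h1
    rw [hx, Pi.smul_apply, h1]
    ext j
    refine Fin.cases rfl (fun i => ?_) j
    have := fderiv_const_smul (hu.1.differentiable (by simp) x) c
    simp [jet, pder, this]

lemma IsTestFun.hasDerivAt_update (hu : IsTestFun D u) (i : Fin n) (x : Fin n → ℝ) (t : ℝ) :
    HasDerivAt (fun t => u (Function.update x i t)) (pder i u (Function.update x i t)) t :=
  ((hu.1.differentiable (by simp) _).hasFDerivAt).comp_hasDerivAt t (_root_.hasDerivAt_update x i t)

/-- Sharp Poincaré inequality in the direction of a bounded coordinate. -/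
lemma IsTestFun.integral_rpow_abs_le_pder {p α β : ℝ} (hp : 1 < p) (hαβ : α < β) {i : Fin n}
    (hu : IsTestFun D u) (hD : ∀ x ∈ D, x i ∈ Ioo α β) :
    (p - 1) * (piP p / (β - α)) ^ p * ∫ x, |u x| ^ p ≤ ∫ x, |pder i u x| ^ p := by
  have hp0 : 0 < p := by linarith
  have hpi := piP_pos hp
  set c := (p - 1) * (piP p / (β - α)) ^ p with hc
  have hc0 : 0 ≤ c := by
    have : 0 < β - α := sub_pos.2 hαβ
    have : 0 < p - 1 := sub_pos.2 hp
    positivity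
  have hUc : Continuous fun x => |u x| ^ p := hu.1.continuous.abs.rpow_const fun _ => Or.inr hp0.le
  have hPc : Continuous fun x => |pder i u x| ^ p :=
    (hu.continuous_pder i).abs.rpow_const fun _ => Or.inr hp0.le
  have hU := hu.1.continuous.integrable_rpow_abs_of_hasCompactSupport hp0 hu.2.1
  have hP := (hu.continuous_pder i).integrable_rpow_abs_of_hasCompactSupport hp0
    (hu.hasCompactSupport_pder i)
  rw [← integral_const_mul, ← ENNReal.ofReal_le_ofReal_iff (integral_nonneg fun x => by positivity),
    ofReal_integral_eq_lintegral_ofReal (hU.const_mul c)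
      (Eventually.of_forall fun x => by positivity),
    ofReal_integral_eq_lintegral_ofReal hP (Eventually.of_forall fun x => by positivity), volume_pi]
  refine lintegral_le_of_lmarginal_le {i}
    (ENNReal.measurable_ofReal.comp (hUc.measurable.const_mul c))
    (ENNReal.measurable_ofReal.comp hPc.measurable) ?_
  rw [lmarginal_singleton, lmarginal_singleton]
  intro x
  have hsub : tsupport (fun t => u (Function.update x i t)) ⊆
      {t | Function.update x i t ∈ tsupport u} :=
    closure_minimal (fun t ht => subset_tsupport u ht)
      ((isClosed_tsupport u).preimage (by fun_prop))
  have hcs : HasCompactSupport fun t => u (Function.update x i t) := by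
    refine (hu.2.1.image (continuous_apply i)).of_isClosed_subset (isClosed_tsupport _) ?_
    exact fun t ht => ⟨_, hsub ht, by simp⟩
  have hd := hu.hasDerivAt_update i x
  have hcs' : HasCompactSupport fun t => pder i u (Function.update x i t) := by
    have : (fun t => pder i u (Function.update x i t)) = deriv fun t => u (Function.update x i t) :=
      funext fun t => (hd t).deriv.symm
    rw [this]; exact hcs.deriv
  have key := integral_rpow_abs_le_of_tsupport_subset_Ioo hp hαβ hd
    ((hu.continuous_pder i).comp (by fun_prop)) hcs
    (fun t ht => by simpa using hD _ (hu.2.2 (hsub ht)))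
  have hU' : Integrable fun t => |u (Function.update x i t)| ^ p :=
    Continuous.integrable_of_hasCompactSupport (hUc.comp (by fun_prop))
      (hcs.comp_left (g := fun x => |x| ^ p) (by simp [Real.zero_rpow hp0.ne']))
  have hP' : Integrable fun t => |pder i u (Function.update x i t)| ^ p :=
    Continuous.integrable_of_hasCompactSupport (hPc.comp (by fun_prop))
      (hcs'.comp_left (g := fun x => |x| ^ p) (by simp [Real.zero_rpow hp0.ne']))
  rw [← integral_const_mul] at key
  beta_reduce
  rw [← ofReal_integral_eq_lintegral_ofReal (hU'.const_mul c)
      (Eventually.of_forall fun x => by positivity),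
    ← ofReal_integral_eq_lintegral_ofReal hP' (Eventually.of_forall fun x => by positivity)]
  exact ENNReal.ofReal_le_ofReal key

end TestFunctions

section StripDomain

open scoped ContDiff

variable {n : ℕ} {D : Set (Fin n → ℝ)} {ψ : Fin n → ℝ → ℝ}

lemma pder_prod (hψ : ∀ j, Differentiable ℝ (ψ j)) (i : Fin n) (x : Fin n → ℝ) :
    pder i (fun x => ∏ j, ψ j (x j)) x =
      ∏ j, Function.update ψ i (deriv (ψ i)) j (x j) := by
  have h : HasFDerivAt (fun x : Fin n → ℝ => ∏ j, ψ j (x j))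
      (∑ j, (∏ l ∈ Finset.univ.erase j, ψ l (x l)) •
        (deriv (ψ j) (x j) • ContinuousLinearMap.proj (R := ℝ) (φ := fun _ : Fin n => ℝ) j)) x :=
    HasFDerivAt.finsetProd fun j _ =>
      (hψ j _).hasDerivAt.comp_hasFDerivAt x (hasFDerivAt_apply j x)
  rw [pder, h.fderiv, ← Finset.mul_prod_erase _ _ (Finset.mem_univ i), Function.update_self,
    Finset.prod_congr rfl fun j hj => by rw [Function.update_of_ne (Finset.ne_of_mem_erase hj)]]
  simp [Pi.single_apply, mul_comm]

lemma isTestFun_prod (hψ : ∀ j, ContDiff ℝ ∞ (ψ j)) (hc : ∀ j, HasCompactSupport (ψ j))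
    (hD : univ.pi (fun j => tsupport (ψ j)) ⊆ D) : IsTestFun D fun x => ∏ j, ψ j (x j) := by
  have hK : IsCompact (univ.pi fun j => tsupport (ψ j)) := isCompact_univ_pi hc
  have hs : Function.support (fun x : Fin n → ℝ => ∏ j, ψ j (x j)) ⊆
      univ.pi fun j => tsupport (ψ j) := fun x hx j _ =>
    subset_tsupport _ (Finset.prod_ne_zero_iff.1 hx j (Finset.mem_univ j))
  exact ⟨contDiff_prod fun j _ => (hψ j).comp (contDiff_apply ℝ ℝ j), hK.of_isClosed_subset
    (isClosed_tsupport _) (closure_minimal hs hK.isClosed),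
    (closure_minimal hs hK.isClosed).trans hD⟩

lemma integral_rpow_abs_prod (p : ℝ) (φ : Fin n → ℝ → ℝ) :
    ∫ x : Fin n → ℝ, |∏ j, φ j (x j)| ^ p = ∏ j, ∫ t, |φ j t| ^ p := by
  simp_rw [Finset.abs_prod, ← Real.finsetProd_rpow _ _ fun _ _ => abs_nonneg _]
  exact integral_fintype_prod_volume_eq_prod fun j t => |φ j t| ^ p

lemma exists_contDiff_integral_rpow_abs_deriv_le_mul {p δ : ℝ} (hp : 1 < p) (hδ : 0 < δ) :
    ∃ u : ℝ → ℝ, ContDiff ℝ ∞ u ∧ HasCompactSupport u ∧ 0 < ∫ t, |u t| ^ p ∧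
      ∫ t, |deriv u t| ^ p ≤ δ * ∫ t, |u t| ^ p := by
  have hpi := piP_pos hp
  have hp1 : 0 < p - 1 := sub_pos.2 hp
  set c := (δ / 2 / (p - 1)) ^ (1 / p) with hc
  have hc0 : 0 < c := by positivity
  obtain ⟨u, hu, hcs, -, hpos, hle⟩ := exists_contDiff_integral_rpow_abs_deriv_le hp
    (div_pos hpi hc0) (half_pos hδ)
  refine ⟨u, hu, hcs, hpos, hle.trans_eq ?_⟩
  have h1 : piP p / (piP p / c - 0) = c := by rw [sub_zero, div_div_cancel₀ hpi.ne']
  have h2 : c ^ p = δ / 2 / (p - 1) := by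
    rw [hc, ← Real.rpow_mul (by positivity), one_div_mul_cancel (by linarith), Real.rpow_one]
  rw [h1, h2, mul_div_cancel₀ _ hp1.ne', add_halves]

/-- The infimum of the Rayleigh quotient `‖∇u‖_p ^ p / ‖u‖_p ^ p` on the strip-like domain. -/
noncomputable def stripEigenvalue (k : ℕ) (p : ℝ) (a b : Fin n → ℝ) : ℝ :=
  ∑ i ∈ Finset.univ.filter (fun i : Fin n => k ≤ (i : ℕ)), (p - 1) * (piP p / (b i - a i)) ^ p

variable {k : ℕ} {p : ℝ} {a b : Fin n → ℝ}

lemma stripEigenvalue_nonneg (hp : 1 < p) (hab : ∀ i : Fin n, k ≤ (i : ℕ) → a i < b i) :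
    0 ≤ stripEigenvalue k p a b := by
  refine Finset.sum_nonneg fun i hi => ?_
  have := piP_pos hp
  have := sub_pos.2 (hab i (Finset.mem_filter.1 hi).2)
  have := sub_pos.2 hp
  positivity

lemma exists_isTestFun_stripDomain {δ : ℝ} (hp : 1 < p)
    (hab : ∀ i : Fin n, k ≤ (i : ℕ) → a i < b i) (hδ : 0 < δ) :
    ∃ u, IsTestFun (stripDomain n k a b) u ∧ 0 < ∫ x, |u x| ^ p ∧
      ∑ i, ∫ x, |pder i u x| ^ p ≤ (stripEigenvalue k p a b + n * δ) * ∫ x, |u x| ^ p := by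
  have h1 : ∀ j : Fin n, ∃ v : ℝ → ℝ, ContDiff ℝ ∞ v ∧ HasCompactSupport v ∧
      (k ≤ (j : ℕ) → tsupport v ⊆ Ioo (a j) (b j)) ∧ 0 < ∫ t, |v t| ^ p ∧
      ∫ t, |deriv v t| ^ p ≤
        ((if k ≤ (j : ℕ) then (p - 1) * (piP p / (b j - a j)) ^ p else 0) + δ) *
          ∫ t, |v t| ^ p := fun j => by
    by_cases hj : k ≤ (j : ℕ)
    · obtain ⟨v, h1, h2, h3, h4, h5⟩ := exists_contDiff_integral_rpow_abs_deriv_le hp (hab j hj) hδ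
      exact ⟨v, h1, h2, fun _ => h3, h4, by rwa [if_pos hj]⟩
    · obtain ⟨v, h1, h2, h4, h5⟩ := exists_contDiff_integral_rpow_abs_deriv_le_mul hp hδ
      exact ⟨v, h1, h2, fun h => absurd h hj, h4, by rwa [if_neg hj, zero_add]⟩
  choose ψ hψ hc hs hpos hle using h1
  refine ⟨fun x => ∏ j, ψ j (x j),
    isTestFun_prod hψ hc fun x hx j hj => hs j hj (hx j (mem_univ j)), ?_, ?_⟩
  · rw [integral_rpow_abs_prod]
    exact Finset.prod_pos fun j _ => hpos j
  have hd := fun j => (hψ j).differentiable (by simp)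
  rw [stripEigenvalue, Finset.sum_filter, ← nsmul_eq_mul, ← Fin.sum_const, ← Finset.sum_add_distrib,
    Finset.sum_mul]
  refine Finset.sum_le_sum fun i _ => ?_
  simp_rw [pder_prod hd]
  rw [integral_rpow_abs_prod, integral_rpow_abs_prod, ← Finset.mul_prod_erase _ _ (Finset.mem_univ i),
    ← Finset.mul_prod_erase _ (fun j => ∫ t, |ψ j t| ^ p) (Finset.mem_univ i), Function.update_self,
    Finset.prod_congr rfl fun j hj => by rw [Function.update_of_ne (Finset.ne_of_mem_erase hj)],
    ← mul_assoc]
  exact mul_le_mul_of_nonneg_right (hle i) (Finset.prod_nonneg fun j _ => (hpos j).le)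

lemma IsTestFun.stripEigenvalue_mul_le {u : (Fin n → ℝ) → ℝ} (hp : 1 < p)
    (hab : ∀ i : Fin n, k ≤ (i : ℕ) → a i < b i) (hu : IsTestFun (stripDomain n k a b) u) :
    stripEigenvalue k p a b * ∫ x, |u x| ^ p ≤ ∑ i, ∫ x, |pder i u x| ^ p := by
  rw [stripEigenvalue, Finset.sum_mul]
  calc _ ≤ ∑ i ∈ Finset.univ.filter (fun i : Fin n => k ≤ (i : ℕ)), ∫ x, |pder i u x| ^ p :=
        Finset.sum_le_sum fun i hi => by
          have hi := (Finset.mem_filter.1 hi).2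
          exact hu.integral_rpow_abs_le_pder hp (hab i hi) fun x hx => hx i hi
    _ ≤ _ := Finset.sum_le_sum_of_subset_of_nonneg (Finset.filter_subset _ _)
        fun i _ _ => integral_nonneg fun x => by positivity

variable [Fact (1 ≤ ENNReal.ofReal p)]

lemma norm_sobolevEmb_stripDomain_le (hp : 1 < p) (hab : ∀ i : Fin n, k ≤ (i : ℕ) → a i < b i) :
    ‖SobolevEmb (ENNReal.ofReal p) (stripDomain n k a b)‖ ≤
      (1 + stripEigenvalue k p a b) ^ (-1 / p) := by
  have hp0 : 0 < p := by linarith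
  have hΛ := stripEigenvalue_nonneg hp hab
  refine ContinuousLinearMap.opNorm_le_bound _ (by positivity) fun f => ?_
  refine closure_minimal (t := {f : Vsp n (ENNReal.ofReal p) |
    ‖(proj0 n (ENNReal.ofReal p)).compLpL (ENNReal.ofReal p) volume f‖ ≤
      (1 + stripEigenvalue k p a b) ^ (-1 / p) * ‖f‖}) (fun g hg => ?_)
    (isClosed_le (by fun_prop) (by fun_prop)) f.2
  obtain ⟨u, hu, hgu⟩ := exists_isTestFun_of_mem_span hg
  rw [mem_ofPred_eq, ← Real.rpow_le_rpow_iff (norm_nonneg _) (by positivity) hp0,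
    Real.mul_rpow (by positivity) (norm_nonneg _), ← Real.rpow_mul (by positivity),
    div_mul_cancel₀ _ hp0.ne', Real.rpow_neg_one, norm_rpow_eq_of_ae_eq_jet hp0 hu g hgu,
    norm_proj0_rpow_eq_of_ae_eq_jet hp0 g hgu, ← div_eq_inv_mul, _root_.le_div_iff₀ (by positivity)]
  linarith [hu.stripEigenvalue_mul_le hp hab]

lemma le_norm_sobolevEmb_stripDomain (hp : 1 < p) (hab : ∀ i : Fin n, k ≤ (i : ℕ) → a i < b i) :
    (1 + stripEigenvalue k p a b) ^ (-1 / p) ≤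
      ‖SobolevEmb (ENNReal.ofReal p) (stripDomain n k a b)‖ := by
  have hp0 : 0 < p := by linarith
  have hΛ := stripEigenvalue_nonneg hp hab
  have hN0 := norm_nonneg (SobolevEmb (ENNReal.ofReal p) (stripDomain n k a b))
  set N := ‖SobolevEmb (ENNReal.ofReal p) (stripDomain n k a b)‖
  have key : ∀ δ : ℝ, 0 < δ → 1 ≤ N ^ p * (1 + stripEigenvalue k p a b + n * δ) := fun δ hδ => by
    obtain ⟨u, hu, hpos, hle⟩ := exists_isTestFun_stripDomain hp hab hδ
    have hf := (hu.memLp_jet (ENNReal.ofReal p)).coeFn_toLp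
    set f := (hu.memLp_jet (ENNReal.ofReal p)).toLp
    have h := (SobolevEmb (ENNReal.ofReal p) (stripDomain n k a b)).le_opNorm
      ⟨f, Submodule.le_topologicalClosure _ (Submodule.subset_span ⟨u, hu, hf⟩)⟩
    have h := Real.rpow_le_rpow (norm_nonneg _) h hp0.le
    rw [Real.mul_rpow hN0 (norm_nonneg _)] at h
    have h1 := norm_rpow_eq_of_ae_eq_jet hp0 hu f hf
    have h2 := norm_proj0_rpow_eq_of_ae_eq_jet hp0 f hf
    change ‖(proj0 n (ENNReal.ofReal p)).compLpL (ENNReal.ofReal p) volume f‖ ^ p ≤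
      N ^ p * ‖f‖ ^ p at h
    rw [h1, h2] at h
    refine le_of_mul_le_mul_right ?_ hpos
    rw [one_mul, mul_assoc]
    refine h.trans (mul_le_mul_of_nonneg_left ?_ (by positivity))
    linarith
  have hlim : Tendsto (fun δ : ℝ => N ^ p * (1 + stripEigenvalue k p a b + n * δ)) (𝓝[>] 0)
      (𝓝 (N ^ p * (1 + stripEigenvalue k p a b + n * 0))) :=
    Continuous.tendsto' (by fun_prop) _ _ rfl |>.mono_left nhdsWithin_le_nhds
  have h := ge_of_tendsto hlim (eventually_mem_nhdsWithin.mono key)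
  rw [mul_zero, add_zero] at h
  rw [← Real.rpow_le_rpow_iff (by positivity) hN0 hp0, ← Real.rpow_mul (by positivity),
    div_mul_cancel₀ _ hp0.ne', Real.rpow_neg_one, inv_le_iff_one_le_mul₀ (by positivity)]
  exact h

end StripDomain

/-- The norm of the canonical embedding `W₀^{1,p}(D) ↪ L^p(D)` on the
strip-like domain `D = ℝᵏ × ∏_{i=1}^{n-k} (aᵢ,bᵢ)` equals
`(1 + π_p^p (p-1) ∑ (bᵢ-aᵢ)^{-p})^{-1/p}`. -/
theorem norm_sobolevEmbedding_stripDomain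
    (n k : ℕ) (hn : 2 ≤ n) (hk : k < n) (p : ℝ) (hp : 1 < p)
    (a b : Fin n → ℝ) (hab : ∀ i : Fin n, k ≤ (i : ℕ) → a i < b i) :
    letI : Fact (1 ≤ ENNReal.ofReal p) := ⟨ENNReal.one_le_ofReal.mpr hp.le⟩
    ‖SobolevEmb (ENNReal.ofReal p) (stripDomain n k a b)‖ =
      (1 + piP p ^ p * (p - 1) *
        ∑ i ∈ Finset.univ.filter (fun i : Fin n => k ≤ (i : ℕ)), (b i - a i) ^ (-p)) ^ (-1 / p) := by

  let : Fact (1 ≤ ENNReal.ofReal p) := ⟨ENNReal.one_le_ofReal.mpr hp.le⟩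
  have h : piP p ^ p * (p - 1) *
      ∑ i ∈ Finset.univ.filter (fun i : Fin n => k ≤ (i : ℕ)), (b i - a i) ^ (-p) =
        stripEigenvalue k p a b := by
    rw [stripEigenvalue, Finset.mul_sum]
    refine Finset.sum_congr rfl fun i hi => ?_
    have hi := (sub_pos.2 (hab i (Finset.mem_filter.1 hi).2)).le
    rw [Real.div_rpow (piP_pos hp).le hi, Real.rpow_neg hi]
    ring
  rw [h]
  exact le_antisymm (norm_sobolevEmb_stripDomain_le hp hab) (le_norm_sobolevEmb_stripDomain hp hab)
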